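/- The point (W, W) of (Set W) × (Set W), i.e. the pair whose both coordinates are the full set of finite binary words, belongs to the boundary ∂Ω₂ = Ω̄₂ ∖ Ω₂, and it is globally fixed by the extended action of Thompson's group F on Ω̄₂: Φ_f(W, W) = (W, W) for every f ∈ F. -/

import Mathlib

open Set MeasureTheory Filter Topology

/-- The binary Cantor space. -/
abbrev CantorC : Type := ℕ → Bool

/-- Finite binary words. -/
abbrev BWord : Type := List Bool

/-- Prepend a finite word to an infinite binary sequence. -/
def wordApp (w : BWord) (x : CantorC) : CantorC := fun n =>
  if h : n < w.length then w.get ⟨n, h⟩ else x (n - w.length)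

/-- The cylinder of sequences beginning with the word `w`. -/
def cyl (w : BWord) : Set CantorC := Set.range (wordApp w)

/-- `J` is a code: both the α-cylinders and the β-cylinders form a partition of the
Cantor space (every point lies in the cylinder of exactly one pair). -/
def IsCode (J : Finset (BWord × BWord)) : Prop :=
  (∀ x : CantorC, ∃! p : BWord × BWord, p ∈ J ∧ x ∈ cyl p.1) ∧
  (∀ x : CantorC, ∃! p : BWord × BWord, p ∈ J ∧ x ∈ cyl p.2)

/-- `J` is order preserving: α ≺ α' lexicographically iff β ≺ β' lexicographically. -/
def OrdPres (J : Finset (BWord × BWord)) : Prop :=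
  ∀ p ∈ J, ∀ q ∈ J, (List.Lex (· < ·) p.1 q.1 ↔ List.Lex (· < ·) p.2 q.2)

/-- The bijection `g` is induced by the code `J` : it maps `β·x` to `α·x`. -/
def InducedBy (J : Finset (BWord × BWord)) (g : Equiv.Perm CantorC) : Prop :=
  ∀ p ∈ J, ∀ x : CantorC, g (wordApp p.2 x) = wordApp p.1 x

/-- `J` is an order-preserving code inducing the bijection `g`. -/
def IsCodeFor (J : Finset (BWord × BWord)) (g : Equiv.Perm CantorC) : Prop :=
  IsCode J ∧ OrdPres J ∧ InducedBy J g

/-- Membership in (the realization on the Cantor space of) Thompson's group `F`. -/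
def InF (g : Equiv.Perm CantorC) : Prop := ∃ J, IsCodeFor J g

/-- The pair `(α, β)` has `|α| ≡ |β| (mod 2)`. -/
def EvenPair (p : BWord × BWord) : Prop := p.1.length % 2 = p.2.length % 2

/-- Membership in the subgroup `H₂` : some order-preserving code for `g` has all
pairs of even length difference. -/
def InH2 (g : Equiv.Perm CantorC) : Prop :=
  ∃ J, IsCodeFor J g ∧ ∀ p ∈ J, EvenPair p

/-- The union of the α-cylinders over pairs of even length difference. -/
def pSet (J : Finset (BWord × BWord)) : Set CantorC :=
  {x | ∃ p ∈ J, EvenPair p ∧ x ∈ cyl p.1}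

/-- The union of the β-cylinders over pairs of even length difference. -/
def eSet (J : Finset (BWord × BWord)) : Set CantorC :=
  {x | ∃ p ∈ J, EvenPair p ∧ x ∈ cyl p.2}

/-- `p_f` : for `f ∈ F` this equals `pSet J` for any (equivalently, every)
order-preserving code `J` for `f`. -/
def pF (g : Equiv.Perm CantorC) : Set CantorC :=
  ⋃ J ∈ {J : Finset (BWord × BWord) | IsCodeFor J g}, pSet J

/-- `E_f` : for `f ∈ F` this equals `eSet J` for any (equivalently, every)
order-preserving code `J` for `f`. -/
def EF (g : Equiv.Perm CantorC) : Set CantorC :=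
  ⋃ J ∈ {J : Finset (BWord × BWord) | IsCodeFor J g}, eSet J

/-- `Ω₂ = {p_f : f ∈ F}`. -/
def Omega2 : Set (Set CantorC) := {p | ∃ g, InF g ∧ pF g = p}

/-- The action `f · p = f(p ∩ E_f) ∪ f((C ∖ p) ∩ (C ∖ E_f))`. -/
def actF (g : Equiv.Perm CantorC) (p : Set CantorC) : Set CantorC :=
  g '' (p ∩ EF g) ∪ g '' (pᶜ ∩ (EF g)ᶜ)

open Classical in
/-- `T(p)` as a Boolean-valued characteristic function: `T(p) w = true` iff the
cylinder of `w` meets `p`. -/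
noncomputable def Tb (p : Set CantorC) : BWord → Bool :=
  fun w => if (cyl w ∩ p).Nonempty then true else false

/-- The embedding `p ↦ (T(p), T(C ∖ p))`. -/
noncomputable def embedT (p : Set CantorC) : (BWord → Bool) × (BWord → Bool) :=
  (Tb p, Tb pᶜ)

/-- `Ω̄₂` : the closure of the image of `Ω₂` under the embedding. -/
noncomputable def OmegaBar : Set ((BWord → Bool) × (BWord → Bool)) :=
  closure (embedT '' Omega2)

theorem wordApp_nil (x : CantorC) : wordApp [] x = x := by
  funext n
  simp [wordApp]

theorem wordApp_append (u v : BWord) (x : CantorC) :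
    wordApp (u ++ v) x = wordApp u (wordApp v x) := by
  funext n
  simp only [wordApp, List.get_eq_getElem, List.length_append]
  by_cases h₁ : n < u.length
  · simp [h₁, Nat.lt_add_right v.length h₁]
  · by_cases h₂ : n < u.length + v.length
    · simp [h₁, h₂, show n - u.length < v.length by omega,
        List.getElem_append_right (not_lt.mp h₁)]
    · simp [h₁, h₂, show ¬ n - u.length < v.length by omega, Nat.sub_add_eq]

theorem wordApp_injective (w : BWord) : Function.Injective (wordApp w) := by
  intro x y h
  funext n
  simpa [wordApp] using congrFun h (w.length + n)

theorem mem_cyl_nil (x : CantorC) : x ∈ cyl [] := ⟨x, wordApp_nil x⟩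

theorem mem_cyl_cons {b : Bool} {w : BWord} {x : CantorC} :
    x ∈ cyl (b :: w) ↔ x 0 = b ∧ (fun n => x (n + 1)) ∈ cyl w := by
  constructor
  · rintro ⟨y, rfl⟩
    refine ⟨by simp [wordApp], y, ?_⟩
    funext n
    simp [wordApp]
  · rintro ⟨h, y, hy⟩
    refine ⟨y, ?_⟩
    funext n
    cases n with
    | zero => simp [wordApp, h]
    | succ n =>
      rw [← congrFun hy n]
      simp [wordApp]

theorem cyl_append_subset (u v : BWord) : cyl (u ++ v) ⊆ cyl u := by
  rintro _ ⟨x, rfl⟩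
  exact ⟨wordApp v x, (wordApp_append u v x).symm⟩

theorem isPrefix_or_isPrefix_of_mem_cyl {u v : BWord} {x : CantorC} (hu : x ∈ cyl u)
    (hv : x ∈ cyl v) : u <+: v ∨ v <+: u := by
  induction u generalizing v x with
  | nil => exact Or.inl List.nil_prefix
  | cons a u ih =>
    cases v with
    | nil => exact Or.inr List.nil_prefix
    | cons b v =>
      rw [mem_cyl_cons] at hu hv
      obtain rfl : a = b := hu.1.symm.trans hv.1
      simpa [List.cons_prefix_cons] using ih hu.2 hv.2

theorem length_le_of_wordApp_eq {u v : BWord} (h : ∀ x, wordApp u x = wordApp v x) :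
    v.length ≤ u.length := by
  by_contra! hlt
  have key : ∀ b : Bool, b = v[u.length] := fun b => by
    simpa [wordApp, hlt] using congrFun (h fun _ => b) u.length
  exact Bool.noConfusion ((key true).trans (key false).symm)

theorem length_eq_of_wordApp_eq {u v : BWord} (h : ∀ x, wordApp u x = wordApp v x) :
    u.length = v.length :=
  le_antisymm (length_le_of_wordApp_eq fun x => (h x).symm) (length_le_of_wordApp_eq h)

theorem evenPair_iff_of_append {g : Equiv.Perm CantorC} {p p' : BWord × BWord}
    (h : ∀ x, g (wordApp p.2 x) = wordApp p.1 x)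
    (h' : ∀ x, g (wordApp p'.2 x) = wordApp p'.1 x) (hpre : p.2 <+: p'.2) :
    EvenPair p ↔ EvenPair p' := by
  obtain ⟨γ, hγ⟩ := hpre
  have hlen : (p.1 ++ γ).length = p'.1.length :=
    length_eq_of_wordApp_eq fun x => by
      rw [wordApp_append, ← h, ← wordApp_append, hγ, h']
  have hlen' := congrArg List.length hγ
  simp only [List.length_append] at hlen hlen'
  unfold EvenPair
  omega

theorem evenPair_iff_of_mem_cyl {J J' : Finset (BWord × BWord)} {g : Equiv.Perm CantorC}
    (hJ : InducedBy J g) (hJ' : InducedBy J' g) {p p' : BWord × BWord} (hp : p ∈ J)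
    (hp' : p' ∈ J') {x : CantorC} (hx : x ∈ cyl p.2) (hx' : x ∈ cyl p'.2) :
    EvenPair p ↔ EvenPair p' := by
  rcases isPrefix_or_isPrefix_of_mem_cyl hx hx' with h | h
  · exact evenPair_iff_of_append (hJ p hp) (hJ' p' hp') h
  · exact (evenPair_iff_of_append (hJ' p' hp') (hJ p hp) h).symm

theorem mem_EF_iff {J : Finset (BWord × BWord)} {g : Equiv.Perm CantorC}
    (hJ : IsCodeFor J g) {p : BWord × BWord} (hp : p ∈ J) {x : CantorC} (hx : x ∈ cyl p.2) :
    x ∈ EF g ↔ EvenPair p := by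
  simp only [EF, mem_iUnion, mem_ofPred_eq, eSet]
  constructor
  · rintro ⟨J', hJ', p', hp', he, hx'⟩
    exact (evenPair_iff_of_mem_cyl hJ.2.2 hJ'.2.2 hp hp' hx hx').2 he
  · exact fun he => ⟨J, hJ, p, hp, he, hx⟩

theorem mem_pF_iff {J : Finset (BWord × BWord)} {g : Equiv.Perm CantorC}
    (hJ : IsCodeFor J g) {p : BWord × BWord} (hp : p ∈ J) {x : CantorC} (hx : x ∈ cyl p.1) :
    x ∈ pF g ↔ EvenPair p := by
  simp only [pF, mem_iUnion, mem_ofPred_eq, pSet]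
  constructor
  · rintro ⟨J', hJ', p', hp', he, y', hy'⟩
    obtain ⟨y, rfl⟩ := hx
    have hy : wordApp p'.2 y' = wordApp p.2 y := g.injective <| by
      rw [hJ.2.2 p hp, hJ'.2.2 p' hp', hy']
    exact (evenPair_iff_of_mem_cyl hJ.2.2 hJ'.2.2 hp hp' ⟨y, rfl⟩ ⟨y', hy⟩).2 he
  · exact fun he => ⟨J, hJ, p, hp, he, hx⟩

/-- Every code induces a bijection of the Cantor space. -/
theorem IsCode.exists_inducedBy {J : Finset (BWord × BWord)} (hJ : IsCode J) :
    ∃ g : Equiv.Perm CantorC, InducedBy J g := by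
  have hf : ∀ x, ∃ z, ∃ p ∈ J, ∃ y, wordApp p.2 y = x ∧ wordApp p.1 y = z := fun x => by
    obtain ⟨p, ⟨hp, y, hy⟩, -⟩ := hJ.2 x
    exact ⟨_, p, hp, y, hy, rfl⟩
  have hf' : ∀ z, ∃ x, ∃ p ∈ J, ∃ y, wordApp p.2 y = x ∧ wordApp p.1 y = z := fun z => by
    obtain ⟨p, ⟨hp, y, hy⟩, -⟩ := hJ.1 z
    exact ⟨_, p, hp, y, rfl, hy⟩
  choose f hf using hf
  choose f' hf' using hf'
  have key : ∀ p ∈ J, ∀ y, f (wordApp p.2 y) = wordApp p.1 y := fun p hp y => by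
    obtain ⟨p', hp', y', h₂, h₁⟩ := hf (wordApp p.2 y)
    obtain rfl := (hJ.2 _).unique ⟨hp', y', h₂⟩ ⟨hp, y, rfl⟩
    rw [← h₁, wordApp_injective _ h₂]
  have key' : ∀ p ∈ J, ∀ y, f' (wordApp p.1 y) = wordApp p.2 y := fun p hp y => by
    obtain ⟨p', hp', y', h₂, h₁⟩ := hf' (wordApp p.1 y)
    obtain rfl := (hJ.1 _).unique ⟨hp', y', h₁⟩ ⟨hp, y, rfl⟩
    rw [← h₂, wordApp_injective _ h₁]
  refine ⟨⟨f, f', fun x => ?_, fun z => ?_⟩, key⟩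
  · obtain ⟨p, hp, y, h₂, h₁⟩ := hf x
    rw [← h₁, key' p hp, h₂]
  · obtain ⟨p, hp, y, h₂, h₁⟩ := hf' z
    rw [← h₂, key p hp, h₁]

/-- Prepending a letter to both words of a pair. -/
def consPair (b : Bool) (p : BWord × BWord) : BWord × BWord := (b :: p.1, b :: p.2)

/-- The code acting as `J` on each of the two cylinders of length one. -/
def doubleCode (J : Finset (BWord × BWord)) : Finset (BWord × BWord) :=
  J.image (consPair false) ∪ J.image (consPair true)

theorem mem_doubleCode {J : Finset (BWord × BWord)} {q : BWord × BWord} :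
    q ∈ doubleCode J ↔ ∃ b, ∃ p ∈ J, consPair b p = q := by
  simp [doubleCode]

theorem evenPair_consPair {b : Bool} {p : BWord × BWord} :
    EvenPair (consPair b p) ↔ EvenPair p := by
  simp only [EvenPair, consPair, List.length_cons]
  omega

theorem isCode_doubleCode {J : Finset (BWord × BWord)} (hJ : IsCode J) :
    IsCode (doubleCode J) := by
  constructor
  · intro x
    obtain ⟨p, ⟨hp, hx⟩, huniq⟩ := hJ.1 fun n => x (n + 1)
    refine ⟨consPair (x 0) p, ⟨mem_doubleCode.2 ⟨_, p, hp, rfl⟩, mem_cyl_cons.2 ⟨rfl, hx⟩⟩, ?_⟩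
    rintro q ⟨hq, hxq⟩
    obtain ⟨b, p', hp', rfl⟩ := mem_doubleCode.1 hq
    obtain ⟨hb, hx'⟩ := mem_cyl_cons.1 hxq
    rw [hb, huniq p' ⟨hp', hx'⟩]
  · intro x
    obtain ⟨p, ⟨hp, hx⟩, huniq⟩ := hJ.2 fun n => x (n + 1)
    refine ⟨consPair (x 0) p, ⟨mem_doubleCode.2 ⟨_, p, hp, rfl⟩, mem_cyl_cons.2 ⟨rfl, hx⟩⟩, ?_⟩
    rintro q ⟨hq, hxq⟩
    obtain ⟨b, p', hp', rfl⟩ := mem_doubleCode.1 hq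
    obtain ⟨hb, hx'⟩ := mem_cyl_cons.1 hxq
    rw [hb, huniq p' ⟨hp', hx'⟩]

theorem ordPres_doubleCode {J : Finset (BWord × BWord)} (hJ : OrdPres J) :
    OrdPres (doubleCode J) := by
  intro q hq q' hq'
  obtain ⟨b, p, hp, rfl⟩ := mem_doubleCode.1 hq
  obtain ⟨b', p', hp', rfl⟩ := mem_doubleCode.1 hq'
  simp only [consPair, List.cons_lex_cons_iff, hJ p hp p' hp']

/-- A code for one of the standard generators of Thompson's group `F`. -/
def generatorCode : Finset (BWord × BWord) :=
  {([false], [false, false]), ([true, false], [false, true]), ([true, true], [true])}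

theorem isCode_generatorCode : IsCode generatorCode := by
  constructor <;> intro x <;> cases h₀ : x 0 <;> cases h₁ : x 1 <;>
    simp [generatorCode, ExistsUnique, mem_cyl_cons, mem_cyl_nil, h₀, h₁, or_and_right,
      exists_or, and_assoc, or_imp] <;> intro a b <;> refine ⟨?_, ?_, ?_⟩ <;> rintro rfl rfl h <;>
    simp_all [mem_cyl_cons]

theorem ordPres_generatorCode : OrdPres generatorCode := by
  unfold OrdPres generatorCode
  decide

/-- Order-preserving codes whose even and odd pairs both refine every word of length at
most `N`. -/
theorem exists_code_mixed (N : ℕ) : ∃ J : Finset (BWord × BWord), IsCode J ∧ OrdPres J ∧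
    ∀ w : BWord, w.length ≤ N →
      (∃ p ∈ J, EvenPair p ∧ w <+: p.1) ∧ ∃ p ∈ J, ¬ EvenPair p ∧ w <+: p.1 := by
  induction N with
  | zero =>
    refine ⟨generatorCode, isCode_generatorCode, ordPres_generatorCode, fun w hw => ?_⟩
    obtain rfl : w = [] := by simpa using hw
    simp [generatorCode, EvenPair]
  | succ N ih =>
    obtain ⟨J, hJ, hJo, hmix⟩ := ih
    refine ⟨doubleCode J, isCode_doubleCode hJ, ordPres_doubleCode hJo, fun w hw => ?_⟩
    cases w with
    | nil =>
      obtain ⟨⟨p, hp, he, -⟩, p', hp', he', -⟩ := hmix [] (Nat.zero_le N)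
      exact ⟨⟨consPair true p, mem_doubleCode.2 ⟨_, p, hp, rfl⟩, evenPair_consPair.2 he,
          List.nil_prefix⟩, consPair true p', mem_doubleCode.2 ⟨_, p', hp', rfl⟩,
          evenPair_consPair.not.2 he', List.nil_prefix⟩
    | cons b w =>
      obtain ⟨⟨p, hp, he, hw₁⟩, p', hp', he', hw₂⟩ := hmix w (by simpa using hw)
      exact ⟨⟨consPair b p, mem_doubleCode.2 ⟨_, p, hp, rfl⟩, evenPair_consPair.2 he,
          List.cons_prefix_cons.2 ⟨rfl, hw₁⟩⟩, consPair b p',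
          mem_doubleCode.2 ⟨_, p', hp', rfl⟩,
          evenPair_consPair.not.2 he', List.cons_prefix_cons.2 ⟨rfl, hw₂⟩⟩

theorem Tb_eq_true_iff {p : Set CantorC} {w : BWord} :
    Tb p w = true ↔ ∃ y, wordApp w y ∈ p := by
  unfold Tb
  split_ifs with h <;> simpa [Set.Nonempty, cyl] using h

theorem exists_Tb_eq_true (N : ℕ) : ∃ q ∈ Omega2, ∀ w : BWord, w.length ≤ N →
    Tb q w = true ∧ Tb qᶜ w = true := by
  obtain ⟨J, hJ, hJo, hmix⟩ := exists_code_mixed N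
  obtain ⟨g, hg⟩ := hJ.exists_inducedBy
  have hcode : IsCodeFor J g := ⟨hJ, hJo, hg⟩
  have hmem : ∀ {p} (hp : p ∈ J) {w γ : BWord} (hγ : w ++ γ = p.1),
      wordApp w (wordApp γ fun _ => true) ∈ pF g ↔ EvenPair p := fun hp _ _ hγ =>
    mem_pF_iff hcode hp (by rw [← wordApp_append, hγ]; exact ⟨_, rfl⟩)
  refine ⟨pF g, ⟨g, ⟨J, hcode⟩, rfl⟩, fun w hw => ?_⟩
  obtain ⟨⟨p, hp, he, γ, hγ⟩, p', hp', he', γ', hγ'⟩ := hmix w hw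
  exact ⟨Tb_eq_true_iff.2 ⟨_, (hmem hp hγ).2 he⟩,
    Tb_eq_true_iff.2 ⟨_, (hmem hp' hγ').not.2 he'⟩⟩

theorem true_mem_OmegaBar :
    ((fun _ => true, fun _ => true) : (BWord → Bool) × (BWord → Bool)) ∈ OmegaBar := by
  choose q hq hT using exists_Tb_eq_true
  refine mem_closure_of_tendsto (f := fun N => embedT (q N)) (b := atTop) ?_
    (Eventually.of_forall fun N => mem_image_of_mem _ (hq N))
  refine Tendsto.prodMk_nhds ?_ ?_ <;> refine tendsto_pi_nhds.2 fun w => ?_ <;>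
    refine tendsto_const_nhds.congr' ?_ <;>
    filter_upwards [eventually_ge_atTop w.length] with N hN
  · exact (hT N w hN).1.symm
  · exact (hT N w hN).2.symm

theorem true_notMem_image :
    ((fun _ => true, fun _ => true) : (BWord → Bool) × (BWord → Bool)) ∉
      embedT '' Omega2 := by
  rintro ⟨_, ⟨g, ⟨J, hJ⟩, rfl⟩, h⟩
  obtain ⟨p, ⟨hp, -⟩, -⟩ := hJ.1.1 fun _ => true
  obtain ⟨y, hy⟩ := Tb_eq_true_iff.1 (congrFun (congrArg Prod.fst h) p.1)
  obtain ⟨z, hz⟩ := Tb_eq_true_iff.1 (congrFun (congrArg Prod.snd h) p.1)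
  exact hz ((mem_pF_iff hJ hp ⟨z, rfl⟩).2 ((mem_pF_iff hJ hp ⟨y, rfl⟩).1 hy))

theorem apply_mem_actF_iff {g : Equiv.Perm CantorC} {q : Set CantorC} {x : CantorC} :
    g x ∈ actF g q ↔ (x ∈ q ↔ x ∈ EF g) := by
  simp only [actF, mem_union, g.injective.mem_set_image, mem_inter_iff, mem_compl_iff]
  tauto

/-- If `q` and its complement meet a suitable cylinder, then `f · q` and its complement
meet a given cylinder. -/
theorem exists_word_Tb_actF {f : Equiv.Perm CantorC} (hf : InF f) (w : BWord) :
    ∃ v : BWord, ∀ q : Set CantorC, Tb q v = true → Tb qᶜ v = true →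
      Tb (actF f q) w = true ∧ Tb (actF f q)ᶜ w = true := by
  obtain ⟨J, hJ⟩ := hf
  obtain ⟨p, ⟨hp, hx⟩, -⟩ := hJ.1.1 (wordApp w fun _ => true)
  obtain ⟨γ, δ, hγ⟩ : ∃ γ δ, p.1 ++ γ = w ++ δ := by
    rcases isPrefix_or_isPrefix_of_mem_cyl hx ⟨_, rfl⟩ with ⟨γ, h⟩ | ⟨δ, h⟩
    · exact ⟨γ, [], by simpa using h⟩
    · exact ⟨[], δ, by simpa using h.symm⟩
  have hmap : ∀ y, wordApp w (wordApp δ y) = f (wordApp (p.2 ++ γ) y) := fun y => by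
    rw [← wordApp_append, ← hγ, wordApp_append, wordApp_append, hJ.2.2 p hp]
  have hE : ∀ y, wordApp (p.2 ++ γ) y ∈ EF f ↔ EvenPair p := fun y =>
    mem_EF_iff hJ hp (cyl_append_subset _ _ ⟨y, rfl⟩)
  refine ⟨p.2 ++ γ, fun q h₁ h₂ => ?_⟩
  obtain ⟨y, hy⟩ := Tb_eq_true_iff.1 h₁
  obtain ⟨z, hz⟩ := Tb_eq_true_iff.1 h₂
  have hact : ∀ t, wordApp w (wordApp δ t) ∈ actF f q ↔
      (wordApp (p.2 ++ γ) t ∈ q ↔ EvenPair p) := fun t => by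
    rw [hmap, apply_mem_actF_iff, hE]
  rw [mem_compl_iff] at hz
  by_cases he : EvenPair p
  · exact ⟨Tb_eq_true_iff.2 ⟨_, (hact y).2 (by tauto)⟩,
      Tb_eq_true_iff.2 ⟨_, (hact z).not.2 (by tauto)⟩⟩
  · exact ⟨Tb_eq_true_iff.2 ⟨_, (hact z).2 (by tauto)⟩,
      Tb_eq_true_iff.2 ⟨_, (hact y).not.2 (by tauto)⟩⟩

/-- the point `(W, W)` (both coordinates the full set of finite binary
words) lies on the boundary `∂Ω₂ = Ω̄₂ ∖ Ω₂` and is fixed by every `Φ_f`, `f ∈ F`. -/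
theorem stmt19 :
    ((fun _ => true, fun _ => true) ∈ OmegaBar ∧
      (fun _ => true, fun _ => true) ∉ embedT '' Omega2) ∧
    ∀ f : Equiv.Perm CantorC, InF f → ∀ Φ : ↥OmegaBar ≃ₜ ↥OmegaBar,
      (∀ q, ∀ hq : q ∈ Omega2,
        (Φ ⟨embedT q, subset_closure (Set.mem_image_of_mem embedT hq)⟩ :
          (BWord → Bool) × (BWord → Bool)) = embedT (actF f q)) →
      ∀ h : ((fun _ => true, fun _ => true) : (BWord → Bool) × (BWord → Bool)) ∈ OmegaBar,
        (Φ ⟨(fun _ => true, fun _ => true), h⟩ :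
          (BWord → Bool) × (BWord → Bool)) = (fun _ => true, fun _ => true) := by
  refine ⟨⟨true_mem_OmegaBar, true_notMem_image⟩, fun f hf Φ hΦ h => ?_⟩
  have key : ∀ w, (Φ ⟨_, h⟩).1.1 w = true ∧ (Φ ⟨_, h⟩).1.2 w = true := fun w => by
    obtain ⟨v, hv⟩ := exists_word_Tb_actF hf w
    let ev : BWord → OmegaBar → Bool × Bool := fun u x => (x.1.1 u, x.1.2 u)
    have hev : ∀ u, Continuous (ev u) := fun u => by fun_prop
    have hopen : IsOpen (ev v ⁻¹' {(true, true)} ∩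
        (ev w ∘ Φ) ⁻¹' {ev w (Φ ⟨_, h⟩)}) :=
      ((isOpen_discrete _).preimage (hev v)).inter
        ((isOpen_discrete _).preimage ((hev w).comp Φ.continuous))
    obtain ⟨U, hU, hUeq⟩ := isOpen_induced_iff.1 hopen
    have hmem : ((fun _ => true, fun _ => true) : (BWord → Bool) × (BWord → Bool)) ∈ U := by
      change (⟨_, h⟩ : OmegaBar) ∈ Subtype.val ⁻¹' U
      rw [hUeq]
      exact ⟨rfl, rfl⟩
    obtain ⟨_, hqU, q, hq, rfl⟩ := mem_closure_iff.1 h U hU hmem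
    have hq' : (⟨embedT q, subset_closure (mem_image_of_mem embedT hq)⟩ : OmegaBar) ∈
        Subtype.val ⁻¹' U := hqU
    rw [hUeq] at hq'
    obtain ⟨h₁, h₂⟩ := hq'
    obtain ⟨hv₁, hv₂⟩ := Prod.mk.inj h₁
    obtain ⟨hw₁, hw₂⟩ := Prod.mk.inj h₂
    rw [hΦ q hq] at hw₁ hw₂
    exact ⟨hw₁.symm.trans (hv q hv₁ hv₂).1, hw₂.symm.trans (hv q hv₁ hv₂).2⟩
  exact Prod.ext (funext fun w => (key w).1) (funext fun w => (key w).2)
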